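/- For integers n ≥ 2 and k ≥ 0, the number of nonnegative basketball walks of length n-1 from 0 to 0 that contain exactly n-1-2k staggered ±2-steps is equal to (1/n)·binomial(2n, k)·binomial(n-k-2, k-1). -/

import Mathlib

/-- Height of a walk (given by its list of steps) after `i` steps. -/
def ht (s : List ℤ) (i : ℕ) : ℤ := (s.take i).sum

/-- A basketball walk: every step lies in `{-2, -1, 1, 2}`. -/
def IsBasketball (s : List ℤ) : Prop := ∀ x ∈ s, x = -2 ∨ x = -1 ∨ x = 1 ∨ x = 2

/-- A C-walk: a basketball walk from 0 to 0 that visits 1 and is positive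
except at its extremities. -/
def IsCWalk (s : List ℤ) : Prop :=
  IsBasketball s ∧ ht s s.length = 0 ∧
    (∀ i, 0 < i → i < s.length → 0 < ht s i) ∧ ∃ i, i ≤ s.length ∧ ht s i = 1

/-- A G-walk: a basketball walk from 0 to 1 that is positive except at the origin. -/
def IsGWalk (s : List ℤ) : Prop :=
  IsBasketball s ∧ ht s s.length = 1 ∧ ∀ i, 1 ≤ i → i ≤ s.length → 0 < ht s i

/-- An A-walk (basketball excursion): a nonnegative basketball walk from 0 to 0. -/
def IsAWalk (s : List ℤ) : Prop :=
  IsBasketball s ∧ ht s s.length = 0 ∧ ∀ i, i ≤ s.length → 0 ≤ ht s i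

/-- A B-walk: a basketball walk from 0 to 1 that visits 0 and 1 only at its extremities. -/
def IsBWalk (s : List ℤ) : Prop :=
  IsBasketball s ∧ ht s s.length = 1 ∧
    ∀ i, 0 < i → i < s.length → ht s i ≠ 0 ∧ ht s i ≠ 1

/-- Number of `±1`-steps of a walk. -/
noncomputable def pmOneSteps (s : List ℤ) : ℕ :=
  Set.ncard {i : ℕ | i < s.length ∧ (s.getD i 0 = 1 ∨ s.getD i 0 = -1)}

/-- Number of steps that are odd `+2`-steps or even `-2`-steps
(the step of index `i`, 0-based, starts at height `ht s i`). -/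
noncomputable def lSteps (s : List ℤ) : ℕ :=
  Set.ncard {i : ℕ | i < s.length ∧
    ((s.getD i 0 = 2 ∧ Odd (ht s i)) ∨ (s.getD i 0 = -2 ∧ Even (ht s i)))}

/-- Number of steps that are odd `-2`-steps or even `+2`-steps. -/
noncomputable def rSteps (s : List ℤ) : ℕ :=
  Set.ncard {i : ℕ | i < s.length ∧
    ((s.getD i 0 = -2 ∧ Odd (ht s i)) ∨ (s.getD i 0 = 2 ∧ Even (ht s i)))}

/-- The (0-based) steps of indices `i < j` are paired: the `i`-th step is a `+2`,
the `j`-th step is a `-2`, the walk after step `j` is back at the height it had before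
step `i`, and strictly in between the walk stays at least one above that height. -/
def Paired (s : List ℤ) (i j : ℕ) : Prop :=
  i < j ∧ j < s.length ∧ s.getD i 0 = 2 ∧ s.getD j 0 = -2 ∧
    ht s (j + 1) = ht s i ∧ ∀ k, i + 1 < k → k ≤ j → ht s i + 1 ≤ ht s k

/-- A staggered `±2`-step: a `±2`-step that is not paired with any other `±2`-step. -/
def IsStaggered (s : List ℤ) (i : ℕ) : Prop :=
  i < s.length ∧ (s.getD i 0 = 2 ∨ s.getD i 0 = -2) ∧
    (∀ j, ¬ Paired s i j) ∧ ∀ j, ¬ Paired s j i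

/-- Number of staggered `±2`-steps of a walk. -/
noncomputable def staggeredCount (s : List ℤ) : ℕ :=
  Set.ncard {i : ℕ | IsStaggered s i}

/-- Combinatorial binomial coefficient on integers: zero unless `0 ≤ b ≤ a`. -/
def ibinom (a b : ℤ) : ℤ :=
  if 0 ≤ b ∧ b ≤ a then (a.toNat.choose b.toNat : ℤ) else 0

section LagrangeInversion

open PowerSeries

variable {R : Type*} [CommRing R]

/-- The coefficient of `z ^ n` in `H (T)`, where `T` is the power series in `z` with
`T = z * φ (T)`. -/
noncomputable def lagrangeCoeff (φ : R⟦X⟧) : ℕ → R⟦X⟧ → R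
  | 0, H => constantCoeff H
  | n + 1, H => lagrangeCoeff φ n (φ * PowerSeries.mk fun p => coeff (p + 1) H)

/-- The power series `H (T)`, where `T = z * φ (T)`. -/
noncomputable def lagrangeSubst (φ H : R⟦X⟧) : R⟦X⟧ := PowerSeries.mk fun n => lagrangeCoeff φ n H

theorem lagrangeCoeff_add (φ : R⟦X⟧) (n : ℕ) (H K : R⟦X⟧) :
    lagrangeCoeff φ n (H + K) = lagrangeCoeff φ n H + lagrangeCoeff φ n K := by
  induction n generalizing H K with
  | zero => simp [lagrangeCoeff]
  | succ n ih =>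
    simp only [lagrangeCoeff]
    rw [← ih, ← mul_add]
    congr 2

theorem lagrangeSubst_add (φ H K : R⟦X⟧) :
    lagrangeSubst φ (H + K) = lagrangeSubst φ H + lagrangeSubst φ K := by
  ext n
  simp [lagrangeSubst, lagrangeCoeff_add]

theorem lagrangeSubst_eq (φ H : R⟦X⟧) :
    lagrangeSubst φ H = X * lagrangeSubst φ (φ * PowerSeries.mk fun p => coeff (p + 1) H) +
      C (constantCoeff H) := by
  ext n
  cases n with
  | zero => simp [lagrangeSubst, lagrangeCoeff]
  | succ n => simp [lagrangeSubst, lagrangeCoeff, coeff_succ_X_mul]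

theorem lagrangeSubst_X_mul (φ H : R⟦X⟧) :
    lagrangeSubst φ (X * H) = X * lagrangeSubst φ (φ * H) := by
  rw [lagrangeSubst_eq]
  have : (PowerSeries.mk fun p => coeff (p + 1) (X * H)) = H := by
    ext p
    simp [coeff_succ_X_mul]
  rw [this]
  simp

theorem lagrangeSubst_C (φ : R⟦X⟧) (r : R) : lagrangeSubst φ (C r) = C r := by
  have h0 : lagrangeSubst φ 0 = 0 := by
    have := lagrangeSubst_add φ 0 0
    simpa using this
  rw [lagrangeSubst_eq]
  have : (PowerSeries.mk fun p => coeff (p + 1) (C r)) = (0 : R⟦X⟧) := by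
    ext p
    simp
  rw [this]
  simp [h0]

theorem lagrangeCoeff_C_mul (φ : R⟦X⟧) (n : ℕ) (r : R) (H : R⟦X⟧) :
    lagrangeCoeff φ n (C r * H) = r * lagrangeCoeff φ n H := by
  induction n generalizing H with
  | zero => simp [lagrangeCoeff]
  | succ n ih =>
    simp only [lagrangeCoeff]
    rw [← ih]
    congr 1
    rw [mul_left_comm]
    congr 1
    ext p
    simp

theorem lagrangeSubst_mul (φ H K : R⟦X⟧) :
    lagrangeSubst φ (H * K) = lagrangeSubst φ H * lagrangeSubst φ K := by
  ext n
  induction n using Nat.strong_induction_on generalizing H K with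
  | _ n ih =>
    obtain ⟨H', a, rfl⟩ : ∃ (H' : R⟦X⟧) (a : R), H = X * H' + C a :=
      ⟨_, _, eq_X_mul_shift_add_const H⟩
    have e1 : (X * H' + C a) * K = X * (H' * K) + C a * K := by ring
    have e2 : lagrangeSubst φ (C a * K) = C a * lagrangeSubst φ K := by
      ext m
      simp [lagrangeSubst, lagrangeCoeff_C_mul]
    rw [e1, lagrangeSubst_add, lagrangeSubst_add, lagrangeSubst_X_mul, lagrangeSubst_X_mul,
      lagrangeSubst_C, e2, add_mul, map_add, map_add, mul_assoc X]
    congr 1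
    cases n with
    | zero => simp
    | succ m =>
      rw [coeff_succ_X_mul, coeff_succ_X_mul, ← mul_assoc φ]
      exact ih m (Nat.lt_succ_self m) _ _

/-- The **Lagrange inversion formula**. -/
theorem succ_mul_lagrangeCoeff [IsDomain R] [CharZero R] (φ : R⟦X⟧) (n : ℕ) (H : R⟦X⟧) :
    ((n : R) + 1) * lagrangeCoeff φ (n + 1) H =
      coeff n (derivative R H * φ ^ (n + 1)) := by
  induction n generalizing H with
  | zero =>
    have := coeff_derivative H 0
    simp_all [lagrangeCoeff, mul_comm]
  | succ n ih =>
    obtain ⟨H', a, rfl⟩ : ∃ (H' : R⟦X⟧) (a : R), H = X * H' + C a :=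
      ⟨_, _, eq_X_mul_shift_add_const H⟩
    have hs : (PowerSeries.mk fun p => coeff (p + 1) (X * H' + C a)) = H' := by
      ext p
      simp [coeff_succ_X_mul]
    have h := ih (φ * H')
    rw [lagrangeCoeff, hs]
    have hne : ((n : R) + 1) ≠ 0 := by exact_mod_cast Nat.succ_ne_zero n
    apply mul_left_cancel₀ hne
    have hd : coeff n (derivative R (φ ^ (n + 2) * H')) =
        coeff (n + 1) (φ ^ (n + 2) * H') * ((n : R) + 1) := coeff_derivative _ n
    have e1 : derivative R (φ ^ (n + 2) * H') =
        ((n : R⟦X⟧) + 2) * (derivative R φ * H' * φ ^ (n + 1)) +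
          φ ^ (n + 2) * derivative R H' := by
      rw [Derivation.leibniz, Derivation.leibniz_pow]
      simp only [smul_eq_mul, nsmul_eq_mul]
      push_cast
      ring
    have e2 : derivative R (φ * H') * φ ^ (n + 1) =
        derivative R φ * H' * φ ^ (n + 1) + φ ^ (n + 2) * derivative R H' := by
      rw [Derivation.leibniz]
      simp only [smul_eq_mul]
      ring
    have e3 : derivative R (X * H' + C a) * φ ^ (n + 1 + 1) =
        φ ^ (n + 2) * H' + X * (φ ^ (n + 2) * derivative R H') := by
      rw [map_add, Derivation.leibniz]
      simp only [smul_eq_mul, derivative_X, derivative_C]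
      ring
    have hc : coeff n (((n : R⟦X⟧) + 2) * (derivative R φ * H' * φ ^ (n + 1))) =
        ((n : R) + 2) * coeff n (derivative R φ * H' * φ ^ (n + 1)) := by
      have : ((n : R⟦X⟧) + 2) = C ((n : R) + 2) := by simp [map_ofNat]
      rw [this, coeff_C_mul]
    rw [e1, map_add, hc] at hd
    rw [e2, map_add] at h
    rw [e3, map_add, coeff_succ_X_mul]
    push_cast
    linear_combination ((n : R) + 2) * h + hd

end LagrangeInversion

section Automaton

/-- Weight of a `-2`-step bringing the walk down to a level with mark `b`: the mark tells
whether the last departure from (or across) that level was a `+2`-step starting on it. -/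
noncomputable def downWeight (b : Bool) : Polynomial ℤ := if b then Polynomial.X ^ 2 else 1

/-- Total weight of the walks of length `n` ending at `0`, when the levels below the current
height carry the given marks, listed from top to bottom. -/
noncomputable def completions : ℕ → List Bool → Polynomial ℤ
  | 0, [] => 1
  | 0, _ :: _ => 0
  | n + 1, [] => Polynomial.X * completions n [false] + completions n [false, true]
  | n + 1, [a] => Polynomial.X * completions n [false, a] + completions n [false, true, a] +
      Polynomial.X * completions n []
  | n + 1, a :: b :: S => Polynomial.X * completions n (false :: a :: b :: S) +
      completions n (false :: true :: a :: b :: S) + Polynomial.X * completions n (b :: S) +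
      downWeight b * completions n S

open PowerSeries

/-- First-passage product for the generating function of `completions`. -/
noncomputable def completionSeries (A E : (Polynomial ℤ)⟦X⟧) :
    List Bool → (Polynomial ℤ)⟦X⟧
  | [] => A
  | [a] => (A * (X * C Polynomial.X) + E * (X * C (downWeight a))) * A
  | a :: b :: S => (A * (X * C Polynomial.X) + E * (X * C (downWeight a))) *
      completionSeries A E (b :: S) + A * (X * C (downWeight b)) * completionSeries A E S

theorem coeff_completionSeries {A E : (Polynomial ℤ)⟦X⟧}
    (hE : E = A * (X * C Polynomial.X * A + X * E))
    (hA : A = 1 + 2 * (X * C Polynomial.X) ^ 2 * A ^ 2 +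
      2 * (X * C Polynomial.X) * X * A * E + (X * C Polynomial.X) ^ 2 * E ^ 2)
    (n : ℕ) (S : List Bool) :
    coeff n (completionSeries A E S) = completions n S := by
  have hf : downWeight false = 1 := rfl
  have ht : C (downWeight true) = (C Polynomial.X : (Polynomial ℤ)⟦X⟧) ^ 2 := by
    simp [downWeight]
  set s : (Polynomial ℤ)⟦X⟧ := C Polynomial.X with hs
  have hβ : A * (1 - X * s * (X * s * A + X * E) - X * ((X * s * A + X * E) *
      (A * (X * s) + E * (X * s ^ 2)) + A * (X * s ^ 2))) = 1 := by
    linear_combination hA + X * (A * (X * s) + E * (X * s ^ 2)) * hE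
  have key0 : completionSeries A E [] = X * (s * completionSeries A E [false] +
      completionSeries A E [false, true]) + 1 := by
    simp only [completionSeries, hf, ht, map_one]
    linear_combination hβ
  have key1 : ∀ a, completionSeries A E [a] = X * (s * completionSeries A E [false, a] +
      completionSeries A E [false, true, a] + s * completionSeries A E []) := by
    intro a
    simp only [completionSeries, hf, ht, map_one]
    generalize C (downWeight a) = w
    linear_combination (A * (X * s) + E * (X * w)) * hβ + (X * w) * (1 + A * X) * hE
  have key2 : ∀ a b S, completionSeries A E (a :: b :: S) =
      X * (s * completionSeries A E (false :: a :: b :: S) +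
      completionSeries A E (false :: true :: a :: b :: S) + s * completionSeries A E (b :: S) +
      C (downWeight b) * completionSeries A E S) := by
    intro a b S
    simp only [completionSeries, hf, ht, map_one]
    generalize C (downWeight a) = w
    generalize C (downWeight b) = v
    generalize completionSeries A E (b :: S) = P
    generalize completionSeries A E S = Q
    linear_combination (X * s * P + (X * s * A + X * E) * X * w * P + X * v * Q) * hβ +
      (1 - X * s * (X * s * A + X * E) - X * ((X * s * A + X * E) *
      (A * (X * s) + E * (X * s ^ 2)) + A * (X * s ^ 2)) + X) * X * w * P * hE
  induction n generalizing S with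
  | zero =>
    match S with
    | [] => rw [key0]; simp [completions]
    | [a] => rw [key1]; simp [completions]
    | a :: b :: S => rw [key2]; simp [completions]
  | succ n ih =>
    match S with
    | [] => rw [key0]; simp [completions, coeff_succ_X_mul, hs, ih, coeff_one]
    | [a] => rw [key1]; simp [completions, coeff_succ_X_mul, hs, ih]
    | a :: b :: S => rw [key2]; simp [completions, coeff_succ_X_mul, hs, ih]

end Automaton

section ClosedForm

open PowerSeries

theorem coeff_X_sq_mul_geometric_pow {R : Type*} [CommRing R] (m k : ℕ) (hm : 1 ≤ m) :
    (coeff m ((X ^ 2 * PowerSeries.mk 1) ^ k : R⟦X⟧) : R) =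
      ((ibinom ((m : ℤ) - k - 1) ((k : ℤ) - 1) : ℤ) : R) := by
  rw [mul_pow, ← pow_mul, coeff_X_pow_mul']
  cases k with
  | zero =>
    simp [ibinom, coeff_one, Nat.one_le_iff_ne_zero.mp hm]
  | succ d =>
    rw [mk_one_pow_eq_mk_choose_add, coeff_mk]
    unfold ibinom
    by_cases h : 2 * (d + 1) ≤ m
    · rw [if_pos h, if_pos (by push_cast; omega)]
      have e1 : ((m : ℤ) - (d + 1 : ℕ) - 1).toNat = d + (m - 2 * (d + 1)) := by omega
      have e2 : (((d + 1 : ℕ) : ℤ) - 1).toNat = d := by omega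
      rw [e1, e2]
      simp
    · rw [if_neg h, if_neg (by push_cast; omega)]
      simp

theorem coeff_completions_nil (m k : ℕ) (hm : 1 ≤ m) :
    ((m : ℤ) + 1) * (completions m []).coeff (2 * k) =
      ((2 * (m + 1)).choose k : ℤ) * ibinom ((m : ℤ) - k - 1) ((k : ℤ) - 1) := by
  set G : (Polynomial ℤ)⟦X⟧ := PowerSeries.mk 1 with hG
  set s : (Polynomial ℤ)⟦X⟧ := C Polynomial.X with hs
  set φ : (Polynomial ℤ)⟦X⟧ := (1 + C (Polynomial.X ^ 2) * (X ^ 2 * G)) ^ 2 with hφ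
  set A := lagrangeSubst φ φ with hA
  set H := lagrangeSubst φ G with hH
  have hone : lagrangeSubst φ 1 = 1 := by simpa using lagrangeSubst_C φ 1
  have hX : lagrangeSubst φ X = X * A := by
    simpa using lagrangeSubst_X_mul φ 1
  have hgeom : H = 1 + X * A * H := by
    have : G = 1 + X * G := by
      have := mk_one_mul_one_sub_eq_one (Polynomial ℤ)
      linear_combination this
    conv_lhs => rw [hH, this, lagrangeSubst_add, lagrangeSubst_mul, hone, hX]
  have hfun : A = (1 + s ^ 2 * ((X * A) ^ 2 * H)) ^ 2 := by
    have : lagrangeSubst φ ((1 + C (Polynomial.X ^ 2) * (X ^ 2 * G)) ^ 2) =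
        (1 + s ^ 2 * ((X * A) ^ 2 * H)) ^ 2 := by
      rw [pow_two (1 + C (Polynomial.X ^ 2) * (X ^ 2 * G)), pow_two (X : (Polynomial ℤ)⟦X⟧)]
      simp only [lagrangeSubst_mul, lagrangeSubst_add, hone, hX, lagrangeSubst_C]
      rw [← hH, hs, map_pow]
      ring
    rwa [← hφ] at this
  have hcoeff : coeff m A = completions m [] := by
    have hE : X * s * A ^ 2 * H = A * (X * s * A + X * (X * s * A ^ 2 * H)) := by
      linear_combination (X * s * A ^ 2) * hgeom
    refine coeff_completionSeries hE ?_ m []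
    linear_combination hfun + 2 * (X * s * A) ^ 2 * hgeom
  have hinv := succ_mul_lagrangeCoeff φ m X
  have hshift : lagrangeCoeff φ (m + 1) X = coeff m A := by
    rw [hA, lagrangeSubst, coeff_mk, lagrangeCoeff]
    have : (PowerSeries.mk fun p => coeff (p + 1) (X : (Polynomial ℤ)⟦X⟧)) = 1 := by
      ext p
      simp [coeff_X, coeff_one]
    rw [this, mul_one]
  rw [hshift, hcoeff, derivative_X, one_mul, hφ, ← pow_mul, add_comm 1, add_pow] at hinv
  have h := congrArg (fun q => Polynomial.coeff q (2 * k)) hinv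
  have hterm : ∀ i, (coeff m ((C (Polynomial.X ^ 2) * (X ^ 2 * G)) ^ i * 1 ^ (2 * (m + 1) - i) *
      ((2 * (m + 1)).choose i : (Polynomial ℤ)⟦X⟧))).coeff (2 * k) =
      if k = i then ((2 * (m + 1)).choose k : ℤ) * ibinom ((m : ℤ) - k - 1) ((k : ℤ) - 1)
      else 0 := by
    intro i
    have e : (C (Polynomial.X ^ 2) * (X ^ 2 * G)) ^ i * 1 ^ (2 * (m + 1) - i) *
        ((2 * (m + 1)).choose i : (Polynomial ℤ)⟦X⟧) =
        C (Polynomial.X ^ (2 * i) * ((2 * (m + 1)).choose i : Polynomial ℤ)) *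
          (X ^ 2 * G) ^ i := by
      rw [mul_pow, map_mul, pow_mul, map_pow C (Polynomial.X ^ 2) i, map_natCast]
      ring
    rw [e, coeff_C_mul, coeff_X_sq_mul_geometric_pow m i hm, mul_assoc,
      Polynomial.coeff_X_pow_mul']
    by_cases hki : k = i
    · subst hki
      simp [← Int.cast_natCast (R := Polynomial ℤ), -Int.cast_natCast, ← Int.cast_mul]
    · rw [if_neg hki]
      split_ifs with hle
      · rw [← Int.cast_natCast (R := Polynomial ℤ), ← Int.cast_mul, ← Polynomial.C_eq_intCast,
          Polynomial.coeff_C, if_neg (by omega)]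
      · rfl
  simp only [map_sum, Polynomial.finsetSum_coeff] at h
  rw [Finset.sum_congr rfl (fun i _ => hterm i), Finset.sum_ite_eq] at h
  have hl : (((m : Polynomial ℤ) + 1) * completions m []).coeff (2 * k) =
      ((m : ℤ) + 1) * (completions m []).coeff (2 * k) := by
    have : ((m : Polynomial ℤ) + 1) = Polynomial.C ((m : ℤ) + 1) := by simp
    rw [this, Polynomial.coeff_C_mul]
  rw [← hl, h]
  split_ifs with hk
  · rfl
  · rw [Nat.choose_eq_zero_of_lt (by simpa using hk)]
    simp

end ClosedForm

section Walks

theorem ht_append (p q : List ℤ) {i : ℕ} (hi : i ≤ p.length) : ht (p ++ q) i = ht p i := by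
  simp [ht, List.take_append_of_le_length hi]

theorem ht_concat_length (p : List ℤ) (u : ℤ) :
    ht (p ++ [u]) (p.length + 1) = ht p p.length + u := by
  simp [ht, List.take_of_length_le]

theorem getD_concat (p : List ℤ) (u : ℤ) {i : ℕ} (hi : i < p.length) :
    (p ++ [u]).getD i 0 = p.getD i 0 := by
  simp [List.getD_eq_getElem?_getD, List.getElem?_append_left hi]

theorem getD_concat_length (p : List ℤ) (u : ℤ) : (p ++ [u]).getD p.length 0 = u := by
  simp

theorem ht_succ (p : List ℤ) {i : ℕ} (hi : i < p.length) :
    ht p (i + 1) = ht p i + p.getD i 0 := by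
  rw [ht, ht, List.take_add_one, List.sum_append]
  simp [List.getD_eq_getElem?_getD, List.getElem?_eq_getElem hi]

/-- Some `+2`-step starting at height `h` has not yet been followed by a return to a height at
most `h`, so that it can still be paired. -/
def OpenAt (p : List ℤ) (h : ℤ) : Prop :=
  ∃ i, i < p.length ∧ p.getD i 0 = 2 ∧ ht p i = h ∧
    ∀ k, i < k → k ≤ p.length → h + 1 ≤ ht p k

theorem OpenAt.lt {p : List ℤ} {h : ℤ} (hp : OpenAt p h) : h < ht p p.length := by
  obtain ⟨i, hi, -, -, hk⟩ := hp
  exact hk _ hi le_rfl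

theorem openAt_concat (p : List ℤ) (u h : ℤ) : OpenAt (p ++ [u]) h ↔
    h < ht p p.length + u ∧ (OpenAt p h ∨ u = 2 ∧ ht p p.length = h) := by
  constructor
  · intro hp
    have hlt := hp.lt
    rw [List.length_append, List.length_singleton, ht_concat_length] at hlt
    refine ⟨hlt, ?_⟩
    obtain ⟨i, hi, h2, hh, hk⟩ := hp
    rw [List.length_append, List.length_singleton] at hi hk
    rcases Nat.lt_succ_iff_lt_or_eq.mp hi with hi | rfl
    · left
      rw [getD_concat p u hi] at h2
      rw [ht_append p _ hi.le] at hh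
      refine ⟨i, hi, h2, hh, fun k hik hkl => ?_⟩
      rw [← ht_append p [u] hkl]
      exact hk k hik (by omega)
    · right
      rw [getD_concat_length] at h2
      rw [ht_append p _ le_rfl] at hh
      exact ⟨h2, hh⟩
  · rintro ⟨hlt, ⟨i, hi, h2, hh, hk⟩ | ⟨rfl, rfl⟩⟩
    · refine ⟨i, by simp; omega, by rwa [getD_concat p u hi], by rwa [ht_append p _ hi.le], ?_⟩
      intro k hik hkl
      rw [List.length_append, List.length_singleton] at hkl
      rcases Nat.lt_or_ge p.length k with h' | h'
      · obtain rfl : k = p.length + 1 := by omega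
        rw [ht_concat_length]
        omega
      · rw [ht_append p _ h']
        exact hk k hik h'
    · refine ⟨p.length, by simp, getD_concat_length p 2, ht_append p _ le_rfl, ?_⟩
      intro k hik hkl
      rw [List.length_append, List.length_singleton] at hkl
      obtain rfl : k = p.length + 1 := by omega
      rw [ht_concat_length]
      omega

/-- The list `S` records, from the top level `c - 1` down to level `0`, which levels are open. -/
def Marks (p : List ℤ) : ℤ → List Bool → Prop
  | c, [] => c = 0
  | c, b :: S => (b = true ↔ OpenAt p (c - 1)) ∧ Marks p (c - 1) S

theorem Marks.eq_length {p : List ℤ} {c : ℤ} {S : List Bool} (h : Marks p c S) :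
    c = S.length := by
  induction S generalizing c with
  | nil => simpa [Marks] using h
  | cons b S ih =>
    have := ih h.2
    push_cast [List.length_cons]
    omega

theorem Marks.congr {p q : List ℤ} {c : ℤ} {S : List Bool} (h : Marks p c S)
    (hpq : ∀ d < c, (OpenAt p d ↔ OpenAt q d)) : Marks q c S := by
  induction S generalizing c with
  | nil => exact h
  | cons b S ih =>
    exact ⟨h.1.trans (hpq _ (by omega)), ih h.2 fun d hd => hpq d (by omega)⟩

theorem Marks.concat {p : List ℤ} {c u : ℤ} {S : List Bool} (h : Marks p c S)
    (hc : c ≤ ht p p.length) (hu : c ≤ ht p p.length + u) : Marks (p ++ [u]) c S := by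
  refine h.congr fun d hd => ?_
  rw [openAt_concat]
  constructor
  · exact fun h => ⟨by omega, Or.inl h⟩
  · rintro ⟨-, h | ⟨-, h⟩⟩
    · exact h
    · omega

/-- Indices of the paired `-2`-steps. -/
def closers (s : List ℤ) : Set ℕ := {j | ∃ i, Paired s i j}

theorem paired_concat (p : List ℤ) (u : ℤ) {i j : ℕ} (hj : j < p.length) :
    Paired (p ++ [u]) i j ↔ Paired p i j := by
  unfold Paired
  refine and_congr_right fun hij => ?_
  rw [getD_concat p u (hij.trans hj), getD_concat p u hj, ht_append p _ (Nat.succ_le_of_lt hj),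
    ht_append p _ (hij.trans hj).le]
  refine and_congr (by simp; omega) (and_congr_right fun _ => and_congr_right fun _ =>
    and_congr_right fun _ => forall_congr' fun k => forall_congr' fun _ => ?_)
  refine forall_congr' fun hk => ?_
  rw [ht_append p _ (hk.trans hj.le)]

theorem exists_paired_length (p : List ℤ) (u : ℤ) :
    (∃ i, Paired (p ++ [u]) i p.length) ↔ u = -2 ∧ OpenAt p (ht p p.length - 2) := by
  constructor
  · rintro ⟨i, hi, -, h2, hu, hh, hk⟩
    rw [getD_concat p u hi] at h2
    rw [getD_concat_length] at hu
    rw [ht_concat_length, ht_append p _ hi.le, hu] at hh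
    refine ⟨hu, i, hi, h2, by omega, fun k hik hkl => ?_⟩
    rcases Nat.lt_or_ge (i + 1) k with h' | h'
    · have := hk k h' hkl
      rw [ht_append p _ hi.le, ht_append p _ hkl] at this
      omega
    · obtain rfl : k = i + 1 := by omega
      rw [ht_succ p hi]
      omega
  · rintro ⟨rfl, i, hi, h2, hh, hk⟩
    refine ⟨i, hi, by simp, by rwa [getD_concat p _ hi], getD_concat_length p _, ?_, ?_⟩
    · rw [ht_concat_length, ht_append p _ hi.le]
      omega
    · intro k hik hkl
      rw [ht_append p _ hi.le, ht_append p _ hkl]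
      have := hk k (by omega) hkl
      omega

theorem ncard_extend {n : ℕ} {T U : Set ℕ} (hT : ∀ j ∈ T, j < n) (hU : ∀ j ∈ U, j < n + 1)
    (hTU : ∀ j < n, (j ∈ U ↔ j ∈ T)) [Decidable (n ∈ U)] :
    U.ncard = T.ncard + if n ∈ U then 1 else 0 := by
  have hfin : T.Finite := (Set.finite_Iio n).subset hT
  split_ifs with h
  · have : U = insert n T := by
      ext j
      rw [Set.mem_insert_iff]
      constructor
      · intro hj
        rcases Nat.lt_succ_iff_lt_or_eq.mp (hU j hj) with h' | h'
        · exact Or.inr ((hTU j h').mp hj)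
        · exact Or.inl h'
      · rintro (rfl | hj)
        · exact h
        · exact (hTU j (hT j hj)).mpr hj
    rw [this, Set.ncard_insert_of_notMem (fun hn => (hT n hn).false) hfin]
  · have : U = T := by
      ext j
      constructor
      · intro hj
        rcases Nat.lt_succ_iff_lt_or_eq.mp (hU j hj) with h' | rfl
        · exact (hTU j h').mp hj
        · exact absurd hj h
      · exact fun hj => (hTU j (hT j hj)).mpr hj
    rw [this, add_zero]

open Classical in
theorem pmOneSteps_concat (p : List ℤ) (u : ℤ) :
    pmOneSteps (p ++ [u]) = pmOneSteps p + if u = 1 ∨ u = -1 then 1 else 0 := by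
  unfold pmOneSteps
  rw [ncard_extend (n := p.length) (T := {i | i < p.length ∧ (p.getD i 0 = 1 ∨ p.getD i 0 = -1)})
    (fun j hj => hj.1) (fun j hj => by simpa using hj.1)]
  · simp only [Set.mem_ofPred_eq, getD_concat_length, List.length_append, List.length_singleton,
      Nat.lt_succ_self, true_and]
  · intro j hj
    simp only [Set.mem_ofPred_eq, getD_concat p u hj, List.length_append, List.length_singleton]
    refine and_congr_left fun _ => ?_
    omega

theorem lt_length_of_mem_closers {s : List ℤ} {j : ℕ} (hj : j ∈ closers s) : j < s.length := by
  obtain ⟨i, hi⟩ := hj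
  exact hi.2.1

open Classical in
theorem ncard_closers_concat (p : List ℤ) (u : ℤ) : (closers (p ++ [u])).ncard =
    (closers p).ncard + if u = -2 ∧ OpenAt p (ht p p.length - 2) then 1 else 0 := by
  rw [ncard_extend (n := p.length) (T := closers p) (U := closers (p ++ [u])) (fun j => lt_length_of_mem_closers)
    (fun j hj => by simpa using lt_length_of_mem_closers hj)
    (fun j hj => exists_congr fun i => paired_concat p u hj)]
  have : p.length ∈ closers (p ++ [u]) ↔ _ := exists_paired_length p u
  simp only [this]

/-- Number of steps that are not staggered, each paired `-2`-step accounting for the `+2`-step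
it is paired with. -/
noncomputable def unstaggered (s : List ℤ) : ℕ := pmOneSteps s + 2 * (closers s).ncard

theorem Paired.left_unique {s : List ℤ} {i i' j : ℕ} (h : Paired s i j) (h' : Paired s i' j) :
    i = i' := by
  wlog hlt : i < i' generalizing i i'
  · rcases Nat.lt_trichotomy i i' with h1 | h1 | h1
    · exact this h h' h1
    · exact h1
    · exact (this h' h h1).symm
  obtain ⟨h1, h2, h3, -, h5, h6⟩ := h
  obtain ⟨h1', -, -, -, h5', -⟩ := h'
  have := ht_succ s (h1.trans h2)
  rcases Nat.lt_or_ge (i + 1) i' with hc | hc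
  · have := h6 i' hc h1'.le
    omega
  · obtain rfl : i' = i + 1 := by omega
    omega

theorem Paired.right_unique {s : List ℤ} {i j j' : ℕ} (h : Paired s i j) (h' : Paired s i j') :
    j = j' := by
  wlog hlt : j < j' generalizing j j'
  · rcases Nat.lt_trichotomy j j' with h1 | h1 | h1
    · exact this h h' h1
    · exact h1
    · exact (this h' h h1).symm
  have := h'.2.2.2.2.2 (j + 1) (by have := h.1; omega) hlt
  have := h.2.2.2.2.1
  omega

theorem staggeredCount_add_unstaggered {s : List ℤ} (hs : IsBasketball s) :
    staggeredCount s + unstaggered s = s.length := by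
  set O : Set ℕ := {i | ∃ j, Paired s i j} with hO
  set M : Set ℕ := {i : ℕ | i < s.length ∧ (s.getD i 0 = 1 ∨ s.getD i 0 = -1)} with hM
  set T : Set ℕ := {i : ℕ | IsStaggered s i} with hT
  have fin : ∀ {U : Set ℕ}, (∀ i ∈ U, i < s.length) → U.Finite :=
    fun h => (Set.finite_Iio s.length).subset h
  have bO : ∀ i ∈ O, i < s.length := fun i ⟨j, hj⟩ => hj.1.trans hj.2.1
  have bC : ∀ i ∈ closers s, i < s.length := fun i => lt_length_of_mem_closers
  have bM : ∀ i ∈ M, i < s.length := fun i hi => hi.1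
  have bT : ∀ i ∈ T, i < s.length := fun i hi => hi.1
  have hOC : O.ncard = (closers s).ncard := by
    choose f hf using fun (i : ℕ) (hi : i ∈ O) => hi
    refine Set.ncard_congr f (fun i hi => ⟨i, hf i hi⟩) (fun a b ha hb hab => ?_) ?_
    · exact (hf a ha).left_unique (hab ▸ hf b hb)
    · rintro j ⟨i, hi⟩
      exact ⟨i, ⟨j, hi⟩, (hf i ⟨j, hi⟩).right_unique hi⟩
  have d1 : Disjoint O (closers s) := by
    refine Set.disjoint_left.mpr ?_
    rintro i ⟨j, hj⟩ ⟨l, hl⟩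
    have h1 := hj.2.2.1
    have h2 := hl.2.2.2.1
    omega
  have d2 : Disjoint M (O ∪ closers s) := by
    refine Set.disjoint_left.mpr ?_
    rintro i ⟨-, hi⟩ (⟨j, hj⟩ | ⟨l, hl⟩)
    · have h1 := hj.2.2.1
      omega
    · have h1 := hl.2.2.2.1
      omega
  have d3 : Disjoint T (M ∪ (O ∪ closers s)) := by
    refine Set.disjoint_left.mpr ?_
    rintro i ⟨-, hi, hi1, hi2⟩ (⟨-, h⟩ | ⟨j, hj⟩ | ⟨l, hl⟩)
    · omega
    · exact hi1 j hj
    · exact hi2 l hl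
  have hall : T ∪ (M ∪ (O ∪ closers s)) = Set.Iio s.length := by
    ext i
    constructor
    · rintro (h | h | h | h)
      exacts [bT i h, bM i h, bO i h, bC i h]
    · intro hi
      have hmem : s.getD i 0 ∈ s := by
        rw [List.getD_eq_getElem s 0 hi]
        exact List.getElem_mem hi
      by_cases h1 : s.getD i 0 = 1 ∨ s.getD i 0 = -1
      · exact Or.inr (Or.inl ⟨hi, h1⟩)
      · by_cases h2 : i ∈ O ∪ closers s
        · exact Or.inr (Or.inr h2)
        · refine Or.inl ⟨hi, ?_, fun j hj => h2 (Or.inl ⟨j, hj⟩), fun j hj => h2 (Or.inr ⟨j, hj⟩)⟩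
          have := hs _ hmem
          omega
  have hcard := congrArg Set.ncard hall
  have hIio : (Set.Iio s.length).ncard = s.length := by
    rw [← Finset.coe_Iio, Set.ncard_coe_finset, Nat.card_Iio]
  rw [hIio, Set.ncard_union_eq d3 (fin bT) ((fin bM).union ((fin bO).union (fin bC))),
    Set.ncard_union_eq d2 (fin bM) ((fin bO).union (fin bC)),
    Set.ncard_union_eq d1 (fin bO) (fin bC), hOC] at hcard
  rw [staggeredCount, unstaggered, pmOneSteps, ← hM, ← hT]
  omega

end Walks

section Enumeration

/-- Prepending a step to a walk. -/
def consStep : ℤ × List ℤ ↪ List ℤ where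
  toFun p := p.1 :: p.2
  inj' p q h := by
    rw [List.cons.injEq] at h
    exact Prod.ext h.1 h.2

theorem consStep_apply (u : ℤ) (s : List ℤ) : consStep (u, s) = u :: s := rfl

/-- The basketball walks of length `n`, as lists of steps. -/
def walks : ℕ → Finset (List ℤ)
  | 0 => {[]}
  | n + 1 => (({-2, -1, 1, 2} : Finset ℤ) ×ˢ walks n).map consStep

theorem mem_walks {n : ℕ} {s : List ℤ} : s ∈ walks n ↔ IsBasketball s ∧ s.length = n := by
  induction n generalizing s with
  | zero =>
    rw [walks, Finset.mem_singleton, List.length_eq_zero_iff]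
    refine ⟨?_, And.right⟩
    rintro rfl
    simp [IsBasketball]
  | succ n ih =>
    cases s with
    | nil => simp [walks, consStep_apply]
    | cons a s =>
      have := ih (s := s)
      simp only [IsBasketball] at this
      simp [walks, consStep_apply, this, IsBasketball, and_assoc]
      aesop

theorem sum_walks_succ {M : Type*} [AddCommMonoid M] (n : ℕ) (f : List ℤ → M) :
    ∑ s ∈ walks (n + 1), f s = ∑ s ∈ walks n, f (-2 :: s) + (∑ s ∈ walks n, f (-1 :: s) +
      (∑ s ∈ walks n, f (1 :: s) + ∑ s ∈ walks n, f (2 :: s))) := by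
  rw [walks, Finset.sum_map, Finset.sum_product]
  simp [consStep_apply]

open Polynomial

/-- The weight of a walk, which vanishes unless the walk is an excursion. -/
noncomputable def excursionWeight (s : List ℤ) : Polynomial ℤ :=
  open Classical in if IsAWalk s then X ^ unstaggered s else 0

theorem excursionWeight_eq_zero {p l : List ℤ} {u : ℤ} (h : ht p p.length + u < 0) :
    excursionWeight (p ++ u :: l) = 0 := by
  rw [excursionWeight, if_neg]
  rintro ⟨-, -, hs⟩
  have := hs (p.length + 1) (by simp)
  rw [show p ++ u :: l = (p ++ [u]) ++ l by simp, ht_append (p ++ [u]) l (by simp),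
    ht_concat_length] at this
  omega

theorem sum_excursionWeight (n : ℕ) {p : List ℤ} {S : List Bool} (hb : IsBasketball p)
    (h0 : ∀ i ≤ p.length, 0 ≤ ht p i) (hS : Marks p (ht p p.length) S) :
    ∑ l ∈ walks n, excursionWeight (p ++ l) = X ^ unstaggered p * completions n S := by
  classical
  induction n generalizing p S with
  | zero =>
    have hl := hS.eq_length
    rw [walks, Finset.sum_singleton, List.append_nil, excursionWeight]
    cases S with
    | nil =>
      rw [if_pos ⟨hb, by simpa using hl, h0⟩]
      simp [completions]
    | cons b S =>
      rw [if_neg]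
      · simp [completions]
      · rintro ⟨-, h, -⟩
        rw [h, List.length_cons] at hl
        omega
  | succ n ih =>
    have hl := hS.eq_length
    have step : ∀ {u : ℤ} {S' : List Bool}, (u = -2 ∨ u = -1 ∨ u = 1 ∨ u = 2) →
        Marks (p ++ [u]) (ht p p.length + u) S' →
        ∑ l ∈ walks n, excursionWeight (p ++ u :: l) =
          X ^ unstaggered (p ++ [u]) * completions n S' := by
      intro u S' hu hS'
      have hlen := hS'.eq_length
      rw [← ih (p := p ++ [u]) (S := S')]
      · simp
      · intro x hx
        rcases List.mem_append.mp hx with hx | hx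
        · exact hb x hx
        · rw [List.mem_singleton.mp hx]
          exact hu
      · intro i hi
        rw [List.length_append, List.length_singleton] at hi
        rcases Nat.lt_or_ge p.length i with h' | h'
        · obtain rfl : i = p.length + 1 := by omega
          rw [ht_concat_length]
          omega
        · rw [ht_append p _ h']
          exact h0 i h'
      · rwa [List.length_append, List.length_singleton, ht_concat_length]
    have zero : ∀ {u : ℤ}, ht p p.length + u < 0 →
        ∑ l ∈ walks n, excursionWeight (p ++ u :: l) = 0 :=
      fun h => Finset.sum_eq_zero fun l _ => excursionWeight_eq_zero h
    have w1 : unstaggered (p ++ [1]) = unstaggered p + 1 := by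
      simp [unstaggered, pmOneSteps_concat, ncard_closers_concat]
      ring
    have wm1 : unstaggered (p ++ [-1]) = unstaggered p + 1 := by
      simp [unstaggered, pmOneSteps_concat, ncard_closers_concat]
      ring
    have w2 : unstaggered (p ++ [2]) = unstaggered p := by
      simp [unstaggered, pmOneSteps_concat, ncard_closers_concat]
    have up1 := step (u := 1) (S' := false :: S) (by simp) (by
      refine ⟨?_, ?_⟩
      · have : ¬ OpenAt p (ht p p.length) := fun h => h.lt.false
        simp [openAt_concat, this]
      · rw [add_sub_cancel_right]
        exact hS.concat le_rfl (by omega))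
    have up2 := step (u := 2) (S' := false :: true :: S) (by simp) (by
      refine ⟨?_, ?_, ?_⟩
      · have : ¬ OpenAt p (ht p p.length + 2 - 1) := fun h => by
          have := h.lt
          omega
        simp [openAt_concat, this]
        omega
      · have e : ht p p.length + 2 - 1 - 1 = ht p p.length := by ring
        simp [openAt_concat, e]
      · have e : ht p p.length + 2 - 1 - 1 = ht p p.length := by ring
        rw [e]
        exact hS.concat le_rfl (by omega))
    rw [sum_walks_succ, up1, up2, w1, w2]
    match S, hS, hl with
    | [], hS, hl =>
      rw [zero (u := -1) (by simp at hl; omega), zero (u := -2) (by simp at hl; omega)]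
      simp only [completions]
      ring
    | [a], hS, hl =>
      rw [zero (u := -2) (by simp at hl; omega),
        step (u := -1) (S' := []) (by simp) (hS.2.concat (by omega) (by omega)), wm1]
      simp only [completions]
      ring
    | a :: b :: S, hS, hl =>
      have e : ht p p.length + -2 = ht p p.length - 1 - 1 := by ring
      rw [step (u := -1) (S' := b :: S) (by simp) (hS.2.concat (by omega) (by omega)), wm1,
        step (u := -2) (S' := S) (by simp) (by
          rw [e]
          exact hS.2.2.concat (by omega) (by omega))]
      have wm2 : (X : Polynomial ℤ) ^ unstaggered (p ++ [-2]) =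
          X ^ unstaggered p * downWeight b := by
        have hb := hS.2.1
        rw [show ht p p.length - 1 - 1 = ht p p.length - 2 by ring] at hb
        simp only [unstaggered, pmOneSteps_concat, ncard_closers_concat, ← hb]
        cases b <;> simp [downWeight]
        ring
      rw [wm2]
      simp only [completions]
      ring

end Enumeration

/-- Refined count of basketball excursions of length `n - 1` with exactly
`n - 1 - 2k` staggered `±2`-steps. -/
theorem stmt9 (n k : ℕ) (hn : 2 ≤ n) :
    (n : ℤ) * Nat.card {s : List ℤ //
        IsAWalk s ∧ s.length = n - 1 ∧
          (staggeredCount s : ℤ) = (n : ℤ) - 1 - 2 * k} =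
      ibinom (2 * n) k * ibinom ((n : ℤ) - k - 2) ((k : ℤ) - 1) := by
  classical
  obtain ⟨m, rfl⟩ : ∃ m, n = m + 1 := ⟨n - 1, by omega⟩
  have hcard : (Nat.card {s : List ℤ // IsAWalk s ∧ s.length = m + 1 - 1 ∧
      (staggeredCount s : ℤ) = ((m + 1 : ℕ) : ℤ) - 1 - 2 * k} : ℤ) =
      (completions m []).coeff (2 * k) := by
    have hnil : unstaggered [] = 0 := by
      simp [unstaggered, pmOneSteps, closers, Paired]
    have hsum := sum_excursionWeight m (p := []) (S := []) (by simp [IsBasketball])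
      (by simp [ht]) (by simp [Marks, ht])
    rw [hnil, pow_zero, one_mul] at hsum
    rw [← hsum, Polynomial.finsetSum_coeff,
      Nat.subtype_card ((walks m).filter fun s => IsAWalk s ∧ unstaggered s = 2 * k),
      Finset.card_filter]
    · push_cast
      refine Finset.sum_congr rfl fun s _ => ?_
      rw [List.nil_append, excursionWeight]
      by_cases hA : IsAWalk s
      · simp [hA, Polynomial.coeff_X_pow, eq_comm]
      · simp [hA]
    · intro s
      rw [Finset.mem_filter, mem_walks, Nat.add_sub_cancel]
      constructor
      · rintro ⟨⟨hb, hl⟩, hA, hu⟩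
        have := staggeredCount_add_unstaggered hb
        exact ⟨hA, hl, by push_cast; omega⟩
      · rintro ⟨hA, hl, hu⟩
        have := staggeredCount_add_unstaggered hA.1
        push_cast at hu
        exact ⟨⟨hA.1, hl⟩, hA, by omega⟩
  have h := coeff_completions_nil m k (by omega)
  rw [hcard]
  push_cast
  rw [h, show (m : ℤ) + 1 - k - 2 = m - k - 1 by ring]
  congr 1
  rw [ibinom]
  split_ifs with hk
  · congr 2
  · rw [Nat.choose_eq_zero_of_lt (by omega), Nat.cast_zero]
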